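/- Slud's inequality (special case used in the paper): for X ~ Binomial(m, μ) with μ ≤ 1/2 and integer k with mμ ≤ k ≤ m(1−μ), we have P(X ≥ k) ≥ 1 − Φ((k − mμ)/√(mμ(1−μ))), where Φ is the standard normal CDF. -/

import Mathlib

open Real

/-- The standard normal cumulative distribution function. -/
noncomputable def stdNormalCDF (t : ℝ) : ℝ :=
  ∫ s in Set.Iic t, Real.exp (-s ^ 2 / 2) / Real.sqrt (2 * π)

/-- The Kullback–Leibler divergence between Bernoulli laws of parameters `x` and `p`. -/
noncomputable def bernoulliKL (x p : ℝ) : ℝ :=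
  x * (log x - log p) + (1 - x) * (log (1 - x) - log (1 - p))

lemma bernoulliKL_self (x : ℝ) : bernoulliKL x x = 0 := by simp [bernoulliKL]

lemma hasDerivAt_bernoulliKL (x : ℝ) {p : ℝ} (hp0 : 0 < p) (hp1 : p < 1) :
    HasDerivAt (bernoulliKL x) ((p - x) / (p * (1 - p))) p := by
  have hq : (1 - p) ≠ 0 := by linarith
  have h1 := (hasDerivAt_log hp0.ne').const_sub (log x) |>.const_mul x
  have h2 := (((hasDerivAt_id p).const_sub 1).log hq).const_sub (log (1 - x)) |>.const_mul (1 - x)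
  refine (h1.add h2).congr_deriv ?_
  simp only [id]
  field_simp
  ring

lemma bernoulliKL_pos {x p : ℝ} (hp : 0 < p) (hpx : p < x) (hx : x < 1) :
    0 < bernoulliKL x p := by
  have hx0 : 0 < x := hp.trans hpx
  have h1 := log_lt_sub_one_of_pos (x := p / x) (by positivity) (by
    rw [Ne, div_eq_one_iff_eq hx0.ne']; exact hpx.ne)
  have hx' : 0 < 1 - x := by linarith
  have hp' : 0 < 1 - p := by linarith
  have h2 := log_le_sub_one_of_pos (x := (1 - p) / (1 - x)) (by positivity)
  rw [log_div hp.ne' hx0.ne'] at h1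
  rw [log_div hp'.ne' hx'.ne'] at h2
  have h3 := mul_lt_mul_of_pos_left h1 hx0
  have h4 := mul_le_mul_of_nonneg_left h2 hx'.le
  have h5 : x * (p / x - 1) = p - x := by field_simp
  have h6 : (1 - x) * ((1 - p) / (1 - x) - 1) = x - p := by field_simp; ring
  unfold bernoulliKL
  linarith

lemma bernoulliKL_le_of_lt {x p : ℝ} (hp : 0 < p) (hpx : p < x) (hx : x < 1) :
    bernoulliKL x p ≤ (x - p) ^ 2 / (2 * p * (1 - x)) := by
  have hx' : 0 < 1 - x := by linarith
  have hd : ∀ t ∈ Set.Icc p x, HasDerivAt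
      (fun t => (x - t) ^ 2 / (2 * t * (1 - x)) - bernoulliKL x t)
      (-((x - t) ^ 2 * (1 + t) / (2 * t ^ 2 * (1 - x) * (1 - t)))) t := by
    intro t ht
    have ht0 : 0 < t := hp.trans_le ht.1
    have ht1 : t < 1 := ht.2.trans_lt hx
    have hq : (1 - t) ≠ 0 := by linarith
    have h1 := ((((hasDerivAt_id t).const_sub x).pow 2).div
      (((hasDerivAt_id t).const_mul 2).mul_const (1 - x)) (by
        simp only [id]; positivity)).sub (hasDerivAt_bernoulliKL x ht0 ht1)
    refine h1.congr_deriv ?_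
    simp only [id]
    field_simp
    simp
    ring
  have hanti := antitoneOn_of_deriv_nonpos (convex_Icc p x)
    (fun t ht => (hd t ht).continuousAt.continuousWithinAt)
    (fun t ht => (hd t (interior_subset ht)).differentiableAt.differentiableWithinAt)
    (fun t ht => by
      have ht := interior_subset ht
      rw [(hd t ht).deriv]
      have ht0 : 0 < t := hp.trans_le ht.1
      have ht1 : 0 < 1 - t := by linarith [ht.2]
      rw [neg_nonpos]
      positivity)
  have := hanti ⟨le_rfl, hpx.le⟩ ⟨hpx.le, le_rfl⟩ hpx.le
  simp only [bernoulliKL_self, sub_self] at this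
  norm_num at this
  exact this

lemma bernoulliKL_le_of_le_one_sub {x p : ℝ} (hp : 0 < p) (hpx : p ≤ x) (hx : x ≤ 1 - p) :
    bernoulliKL x p ≤ (x - p) ^ 2 / (2 * (p * (1 - p))) := by
  have hp' : 0 < 1 - p := by linarith
  set h' : ℝ → ℝ := fun t => (t - p) / (p * (1 - p)) - (log t - log p) + (log (1 - t) - log (1 - p))
    with hh'
  have hd2 : ∀ t ∈ Set.Icc p x, HasDerivAt h'
      (1 / (p * (1 - p)) - 1 / t - 1 / (1 - t)) t := by
    intro t ht
    have ht0 : 0 < t := hp.trans_le ht.1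
    have hq : 0 < 1 - t := by linarith [ht.2]
    have h1 := ((((hasDerivAt_id t).sub_const p).div_const (p * (1 - p))).sub
      ((hasDerivAt_log ht0.ne').sub_const (log p))).add
      ((((hasDerivAt_id t).const_sub 1).log hq.ne').sub_const (log (1 - p)))
    refine h1.congr_deriv ?_
    simp only [id]
    ring
  have hd1 : ∀ t ∈ Set.Icc p x, HasDerivAt
      (fun t => (t - p) ^ 2 / (2 * (p * (1 - p))) - bernoulliKL t p) (h' t) t := by
    intro t ht
    have ht0 : 0 < t := hp.trans_le ht.1
    have hq : 0 < 1 - t := by linarith [ht.2]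
    have hi := hasDerivAt_id t
    have h1 := (((hi.sub_const p).pow 2).div_const (2 * (p * (1 - p)))).sub
      ((hi.mul ((hasDerivAt_log ht0.ne').sub_const (log p))).add
      ((hi.const_sub 1).mul (((hi.const_sub 1).log hq.ne').sub_const (log (1 - p)))))
    refine h1.congr_deriv ?_
    simp only [id, hh']
    field_simp
    simp
    ring
  have hm2 := monotoneOn_of_deriv_nonneg (convex_Icc p x)
    (fun t ht => (hd2 t ht).continuousAt.continuousWithinAt)
    (fun t ht => (hd2 t (interior_subset ht)).differentiableAt.differentiableWithinAt)
    (fun t ht => by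
      have ht := interior_subset ht
      rw [(hd2 t ht).deriv]
      have ht0 : 0 < t := hp.trans_le ht.1
      have hq : 0 < 1 - t := by linarith [ht.2]
      have : 1 / (p * (1 - p)) - 1 / t - 1 / (1 - t) =
          (t - p) * (1 - p - t) / (p * (1 - p) * (t * (1 - t))) := by
        field_simp
        ring
      rw [this]
      have h3 : 0 ≤ t - p := by linarith [ht.1]
      have h4 : 0 ≤ 1 - p - t := by linarith [ht.2]
      positivity)
  have hm1 := monotoneOn_of_deriv_nonneg (convex_Icc p x)
    (fun t ht => (hd1 t ht).continuousAt.continuousWithinAt)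
    (fun t ht => (hd1 t (interior_subset ht)).differentiableAt.differentiableWithinAt)
    (fun t ht => by
      have ht := interior_subset ht
      rw [(hd1 t ht).deriv]
      have := hm2 ⟨le_rfl, hpx⟩ ht ht.1
      simpa [hh'] using this)
  have := hm1 ⟨le_rfl, hpx⟩ ⟨hpx, le_rfl⟩ hpx
  simp only [bernoulliKL_self, sub_self] at this
  norm_num at this
  exact this

lemma monotoneOn_sq_div_bernoulliKL {x : ℝ} (hx : x < 1) :
    MonotoneOn (fun p => ((x - p) / (1 - p)) ^ 2 / bernoulliKL x p) (Set.Ioo 0 x) := by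
  have hd : ∀ t ∈ Set.Ioo 0 x, HasDerivAt
      (fun p => ((x - p) / (1 - p)) ^ 2 / bernoulliKL x p)
      ((x - t) / ((1 - t) ^ 3 * bernoulliKL x t ^ 2) *
        ((x - t) ^ 2 / t - 2 * (1 - x) * bernoulliKL x t)) t := by
    intro t ht
    have hq : 0 < 1 - t := by linarith [ht.2]
    have hD := bernoulliKL_pos ht.1 ht.2 hx
    have hi := hasDerivAt_id t
    have h1 := (((hi.const_sub x).div (hi.const_sub 1) hq.ne').pow 2).div
      (hasDerivAt_bernoulliKL x ht.1 (by linarith)) hD.ne'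
    refine h1.congr_deriv ?_
    have ht0 := ht.1
    simp only [id, Pi.div_apply, Pi.pow_apply]
    norm_num
    field_simp
    ring
  refine monotoneOn_of_deriv_nonneg (convex_Ioo 0 x)
    (fun t ht => (hd t ht).continuousAt.continuousWithinAt)
    (fun t ht => (hd t (interior_subset ht)).differentiableAt.differentiableWithinAt)
    (fun t ht => ?_)
  have ht := interior_subset ht
  rw [(hd t ht).deriv]
  have ht0 := ht.1
  have hx' : 0 < 1 - x := by linarith
  have hq : 0 < 1 - t := by linarith [ht.2]
  have h0 : 0 < x - t := by linarith [ht.2]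
  have hD := bernoulliKL_pos ht.1 ht.2 hx
  have h := bernoulliKL_le_of_lt ht.1 ht.2 hx
  have h2 : 0 ≤ (x - t) ^ 2 / t - 2 * (1 - x) * bernoulliKL x t := by
    have h3 := mul_le_mul_of_nonneg_left h (by positivity : 0 ≤ 2 * (1 - x))
    have h4 : 2 * (1 - x) * ((x - t) ^ 2 / (2 * t * (1 - x))) = (x - t) ^ 2 / t := by
      field_simp
    linarith
  positivity

lemma bernoulliKL_sq_div_le {x t : ℝ} (hx : 0 < x) (hxt : x ≤ t) (ht : t < 1) :
    bernoulliKL x (x ^ 2 / t) ≤ bernoulliKL x t := by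
  have hd : ∀ s ∈ Set.Icc x t, HasDerivAt
      (fun s => bernoulliKL x s - bernoulliKL x (x ^ 2 / s))
      ((s - x) ^ 2 * (1 + x) / (s * (1 - s) * (s - x ^ 2))) s := by
    intro s hs
    have hs0 : 0 < s := hx.trans_le hs.1
    have hs1 : 0 < 1 - s := by linarith [hs.2]
    have hs2 : 0 < s - x ^ 2 := by nlinarith [hs.1]
    have hlt : x ^ 2 / s < 1 := by rw [div_lt_one hs0]; linarith
    have h1 := (hasDerivAt_bernoulliKL x hs0 (by linarith)).sub
      ((hasDerivAt_bernoulliKL x (p := x ^ 2 / s) (by positivity) hlt).comp s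
      ((hasDerivAt_const s (x ^ 2)).div (hasDerivAt_id s) hs0.ne'))
    refine h1.congr_deriv ?_
    have : 1 - x ^ 2 / s = (s - x ^ 2) / s := by field_simp
    rw [this]
    field_simp
    ring
  have hm := monotoneOn_of_deriv_nonneg (convex_Icc x t)
    (fun s hs => (hd s hs).continuousAt.continuousWithinAt)
    (fun s hs => (hd s (interior_subset hs)).differentiableAt.differentiableWithinAt)
    (fun s hs => by
      have hs := interior_subset hs
      rw [(hd s hs).deriv]
      have hs0 : 0 < s := hx.trans_le hs.1
      have hs1 : 0 < 1 - s := by linarith [hs.2]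
      have hs2 : 0 < s - x ^ 2 := by nlinarith [hs.1]
      positivity)
  have := hm ⟨le_rfl, hxt⟩ ⟨hxt, le_rfl⟩ hxt
  have h2 : x ^ 2 / x = x := by field_simp
  simp only [h2, sub_self] at this
  linarith

lemma pow_mul_pow_eq_exp_bernoulliKL {k b : ℕ} {n x t : ℝ} (hk : n * x = k)
    (hb : n * (1 - x) = b) (hx0 : 0 < x) (hx1 : x < 1) (ht0 : 0 < t) (ht1 : t < 1) :
    t ^ k * (1 - t) ^ b = x ^ k * (1 - x) ^ b * exp (-(n * bernoulliKL x t)) := by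
  have hx' : 0 < 1 - x := by linarith
  have ht' : 0 < 1 - t := by linarith
  rw [← exp_log (by positivity : 0 < t ^ k * (1 - t) ^ b),
    ← exp_log (by positivity : 0 < x ^ k * (1 - x) ^ b), ← exp_add]
  congr 1
  rw [log_mul (by positivity) (by positivity), log_mul (by positivity) (by positivity),
    log_pow, log_pow, log_pow, log_pow, ← hk, ← hb, bernoulliKL]
  ring

lemma tendsto_bernoulliKL_zero {x : ℝ} (hx : 0 < x) :
    Filter.Tendsto (bernoulliKL x) (nhdsWithin 0 (Set.Ioi 0)) Filter.atTop := by
  unfold bernoulliKL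
  have h1 : Filter.Tendsto (fun p => x * (log x - log p)) (nhdsWithin 0 (Set.Ioi 0))
      Filter.atTop := by
    refine Filter.Tendsto.const_mul_atTop hx ?_
    simp only [sub_eq_add_neg]
    exact Filter.tendsto_atTop_add_const_left _ _
      (Filter.tendsto_neg_atBot_atTop.comp tendsto_log_nhdsGT_zero)
  have h2 : ContinuousAt (fun p : ℝ => (1 - x) * (log (1 - x) - log (1 - p))) 0 := by
    have : (1 : ℝ) - 0 ≠ 0 := by norm_num
    fun_prop (disch := assumption)
  exact h1.atTop_add (h2.tendsto.mono_left nhdsWithin_le_nhds)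

lemma integrable_exp_neg_sq_div_two_div (c : ℝ) :
    MeasureTheory.Integrable fun s : ℝ => exp (-s ^ 2 / 2) / c := by
  have := (integrable_exp_neg_mul_sq (b := 1 / 2) (by norm_num)).div_const c
  refine this.congr (Filter.Eventually.of_forall fun s => ?_)
  simp only
  ring_nf

lemma stdNormalCDF_zero : stdNormalCDF 0 = 1 / 2 := by
  have h := integral_comp_neg_Iic 0 (fun s : ℝ => exp (-s ^ 2 / 2) / √(2 * π))
  have h2 := integral_gaussian_Ioi (1 / 2)
  have h3 : (fun s : ℝ => exp (-s ^ 2 / 2)) = fun s => exp (-(1 / 2) * s ^ 2) := by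
    ext s; ring_nf
  have h4 : π / (1 / 2) = 2 * π := by ring
  simp only [neg_sq, neg_zero] at h
  rw [stdNormalCDF, h, MeasureTheory.integral_div, h3, h2, h4]
  have : √(2 * π) ≠ 0 := by positivity
  field_simp

lemma monotone_stdNormalCDF : Monotone stdNormalCDF := by
  intro a b hab
  refine MeasureTheory.setIntegral_mono_set (integrable_exp_neg_sq_div_two_div _).integrableOn
    (Filter.Eventually.of_forall fun s => by positivity)
    (Filter.Eventually.of_forall (Set.Iic_subset_Iic.2 hab))

lemma hasDerivAt_stdNormalCDF (t : ℝ) :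
    HasDerivAt stdNormalCDF (exp (-t ^ 2 / 2) / √(2 * π)) t := by
  have hI := integrable_exp_neg_sq_div_two_div √(2 * π)
  have hc : Continuous fun s : ℝ => exp (-s ^ 2 / 2) / √(2 * π) := by fun_prop
  have h := (hc.integral_hasStrictDerivAt 0 t).hasDerivAt.const_add (stdNormalCDF 0)
  refine h.congr_of_eventuallyEq (Filter.Eventually.of_forall fun s => ?_)
  have := intervalIntegral.integral_Iic_sub_Iic (hI.integrableOn (s := Set.Iic 0))
    (hI.integrableOn (s := Set.Iic s))
  simp only [← this, stdNormalCDF]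
  ring

lemma tendsto_stdNormalCDF_atTop :
    Filter.Tendsto stdNormalCDF Filter.atTop (nhds 1) := by
  have hI := integrable_exp_neg_sq_div_two_div √(2 * π)
  have h := (MeasureTheory.aecover_Iic (μ := MeasureTheory.volume)
    Filter.tendsto_id).integral_tendsto_of_countably_generated hI
  have h3 : (fun s : ℝ => exp (-s ^ 2 / 2)) = fun s => exp (-(1 / 2) * s ^ 2) := by
    ext s; ring_nf
  have h4 : π / (1 / 2) = 2 * π := by ring
  rw [MeasureTheory.integral_div, h3, integral_gaussian, h4, div_self (by positivity)] at h
  exact h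

lemma nonneg_of_deriv_sign_change {W W' : ℝ → ℝ} {x : ℝ}
    (hc : ContinuousOn W (Set.Ioc 0 x)) (hd : ∀ p ∈ Set.Ioo 0 x, HasDerivAt W (W' p) p)
    (hsign : ∀ p q, 0 < p → p ≤ q → q < x → 0 < W' q → 0 ≤ W' p) (hWx : 0 ≤ W x)
    (hlim : ∀ ε > 0, ∀ᶠ p in nhdsWithin 0 (Set.Ioi 0), -ε < W p) {p : ℝ} (hp : p ∈ Set.Ioc 0 x) :
    0 ≤ W p := by
  by_contra! hneg
  have hpx : p < x := hp.2.lt_of_ne (by rintro rfl; linarith)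
  obtain ⟨ξ, hξ, hξ'⟩ := exists_hasDerivAt_eq_slope W W' hpx
    (hc.mono fun t ht => ⟨hp.1.trans_le ht.1, ht.2⟩)
    (fun t ht => hd t ⟨hp.1.trans ht.1, ht.2⟩)
  have hpos : 0 < W' ξ := by
    rw [hξ']
    exact div_pos (by linarith) (by linarith)
  have hmono : MonotoneOn W (Set.Ioc 0 p) :=
    monotoneOn_of_deriv_nonneg (convex_Ioc 0 p)
      (hc.mono fun t ht => ⟨ht.1, ht.2.trans hp.2⟩)
      (fun t ht => by
        rw [interior_Ioc] at ht
        exact (hd t ⟨ht.1, ht.2.trans hpx⟩).differentiableAt.differentiableWithinAt)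
      (fun t ht => by
        rw [interior_Ioc] at ht
        rw [(hd t ⟨ht.1, ht.2.trans hpx⟩).deriv]
        exact hsign t ξ ht.1 (ht.2.trans hξ.1).le hξ.2 hpos)
  obtain ⟨q, hq1, hq2⟩ := ((hlim (-W p) (by linarith)).and
    (Ioc_mem_nhdsGT hp.1)).exists
  have := hmono hq2 ⟨hp.1, le_rfl⟩ hq2.2
  linarith

/-- The upper tail `P(X ≥ k)` of a binomial variable `X` with `m` trials and parameter `p`. -/
noncomputable def binomialTail (m k : ℕ) (p : ℝ) : ℝ :=
  ∑ j ∈ Finset.Icc k m, (m.choose j : ℝ) * p ^ j * (1 - p) ^ (m - j)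

lemma binomialTail_eq_eval (m k : ℕ) (p : ℝ) :
    binomialTail m k p =
      (∑ j ∈ Finset.Icc k m, bernsteinPolynomial ℝ m j).eval p := by
  simp [binomialTail, bernsteinPolynomial, Polynomial.eval_finsetSum]

lemma binomialTail_nonneg (m k : ℕ) {p : ℝ} (hp0 : 0 ≤ p) (hp1 : p ≤ 1) :
    0 ≤ binomialTail m k p := by
  have : 0 ≤ 1 - p := by linarith
  exact Finset.sum_nonneg fun j _ => by positivity

lemma binomialTail_zero (m : ℕ) (p : ℝ) : binomialTail m 0 p = 1 := by
  rw [binomialTail_eq_eval, ← Nat.range_succ_eq_Icc_zero, bernsteinPolynomial.sum]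
  simp

lemma binomialTail_at_one {m k : ℕ} (hk : k ≤ m) : binomialTail m k 1 = 1 := by
  simp [binomialTail_eq_eval, Polynomial.eval_finsetSum, bernsteinPolynomial.eval_at_1, hk]

lemma hasDerivAt_binomialTail (m a : ℕ) (p : ℝ) (ha : a < m) :
    HasDerivAt (binomialTail m (a + 1))
      (m * (m - 1).choose a * (p ^ a * (1 - p) ^ (m - (a + 1)))) p := by
  have h := (∑ j ∈ Finset.Icc (a + 1) m, bernsteinPolynomial ℝ m j).hasDerivAt p
  have hfun : binomialTail m (a + 1) =
      fun p => (∑ j ∈ Finset.Icc (a + 1) m, bernsteinPolynomial ℝ m j).eval p :=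
    funext (binomialTail_eq_eval m (a + 1))
  rw [hfun]
  refine h.congr_deriv ?_
  have hs : Finset.Icc (a + 1) m = Finset.Ico (a + 1) (m + 1) := by ext; simp
  rw [Polynomial.derivative_sum, hs,
    ← Finset.sum_Ico_add' (fun j => Polynomial.derivative (bernsteinPolynomial ℝ m j)) a m 1]
  simp only [bernsteinPolynomial.derivative_succ]
  have ht := Finset.sum_Ico_sub (fun j => -bernsteinPolynomial ℝ (m - 1) j) ha.le
  simp only [neg_sub_neg] at ht
  rw [← Finset.mul_sum, ht, bernsteinPolynomial.eq_zero_of_lt ℝ (show m - 1 < m by omega)]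
  simp only [bernsteinPolynomial, Polynomial.eval_mul, Polynomial.eval_sub,
    Polynomial.eval_pow, Polynomial.eval_X, Polynomial.eval_one, Polynomial.eval_natCast,
    Polynomial.eval_zero]
  rw [show m - 1 - a = m - (a + 1) by omega]
  ring

lemma half_le_binomialTail {m a : ℕ} {x : ℝ} (hx0 : 0 < x) (hx1 : x < 1)
    (hmx : m * x = (a + 1 : ℕ)) (ham : a + 1 < m) : 1 / 2 ≤ binomialTail m (a + 1) x := by
  have hF := fun p => hasDerivAt_binomialTail m a p (by omega)
  have hb : (m : ℝ) * (1 - x) = (m - (a + 1) : ℕ) := by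
    rw [Nat.cast_sub ham.le, mul_sub, hmx, mul_one]
  set C : ℝ := m * (m - 1).choose a
  set b := m - (a + 1)
  have hC : 0 ≤ C := by positivity
  have hd : ∀ t ∈ Set.Icc x 1, HasDerivAt
      (fun t => binomialTail m (a + 1) t + binomialTail m (a + 1) (x ^ 2 / t))
      (C * (t ^ a * (1 - t) ^ b) -
        C * ((x ^ 2 / t) ^ a * (1 - x ^ 2 / t) ^ b) * (x ^ 2 / t ^ 2)) t := by
    intro t ht
    have ht0 : t ≠ 0 := (hx0.trans_le ht.1).ne'
    have h1 := (hF t).add ((hF (x ^ 2 / t)).comp t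
      ((hasDerivAt_const t (x ^ 2)).div (hasDerivAt_id t) ht0))
    refine h1.congr_deriv ?_
    simp only [id]
    ring
  have hm := antitoneOn_of_deriv_nonpos (convex_Icc x 1)
    (fun s hs => (hd s hs).continuousAt.continuousWithinAt)
    (fun s hs => (hd s (interior_subset hs)).differentiableAt.differentiableWithinAt)
    (fun t ht => by
      rw [(hd t (interior_subset ht)).deriv]
      rw [interior_Icc] at ht
      have ht0 : 0 < t := hx0.trans ht.1
      have hlt : x ^ 2 / t < 1 := by rw [div_lt_one ht0]; nlinarith [ht.1]
      have hx' : 0 < 1 - x := by linarith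
      have hle := bernoulliKL_sq_div_le hx0 ht.1.le ht.2
      have h1 := pow_mul_pow_eq_exp_bernoulliKL hmx hb hx0 hx1 ht0 ht.2
      have h2 := pow_mul_pow_eq_exp_bernoulliKL hmx hb hx0 hx1
        (by positivity : 0 < x ^ 2 / t) hlt
      have h3 : t ^ (a + 1) * (1 - t) ^ b ≤ (x ^ 2 / t) ^ (a + 1) * (1 - x ^ 2 / t) ^ b := by
        rw [h1, h2]
        gcongr
      have h4 := mul_le_mul_of_nonneg_left h3 (div_nonneg hC ht0.le)
      have h5 : C / t * (t ^ (a + 1) * (1 - t) ^ b) = C * (t ^ a * (1 - t) ^ b) := by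
        rw [pow_succ]
        field_simp
      have h6 : C / t * ((x ^ 2 / t) ^ (a + 1) * (1 - x ^ 2 / t) ^ b) =
          C * ((x ^ 2 / t) ^ a * (1 - x ^ 2 / t) ^ b) * (x ^ 2 / t ^ 2) := by
        rw [pow_succ]
        ring
      linarith)
  have h := hm ⟨le_rfl, hx1.le⟩ ⟨hx1.le, le_rfl⟩ hx1.le
  have h2 : x ^ 2 / x = x := by field_simp
  simp only [h2, binomialTail_at_one ham.le, div_one] at h
  have := binomialTail_nonneg m (a + 1) (sq_nonneg x) (by nlinarith)
  linarith

lemma one_sub_stdNormalCDF_sqrt_le_binomialTail {m a : ℕ} {x p : ℝ} (hx1 : x < 1)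
    (hmx : m * x = (a + 1 : ℕ)) (ham : a + 1 < m) (hp0 : 0 < p) (hpx : p ≤ x) :
    1 - stdNormalCDF √(2 * m * bernoulliKL x p) ≤ binomialTail m (a + 1) p := by
  have hx0 : 0 < x := hp0.trans_le hpx
  have hm0 : (0 : ℝ) < m := by exact_mod_cast (by omega : 0 < m)
  have hF := fun p => hasDerivAt_binomialTail m a p (by omega)
  have hb : (m : ℝ) * (1 - x) = (m - (a + 1) : ℕ) := by
    rw [Nat.cast_sub ham.le, mul_sub, hmx, mul_one]
  set C : ℝ := m * (m - 1).choose a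
  set b := m - (a + 1)
  have hx' : 0 < 1 - x := by linarith
  set L : ℝ := m / (x ^ (a + 1) * (1 - x) ^ b * √(2 * π)) with hL
  have hLpos : 0 < L := by positivity
  set τ : ℝ → ℝ := fun t => √(((x - t) / (1 - t)) ^ 2 / bernoulliKL x t / (2 * m)) with hτ
  have hτmono : MonotoneOn τ (Set.Ioo 0 x) := fun s hs t ht hst => by
    have := monotoneOn_sq_div_bernoulliKL hx1 hs ht hst
    simp only at this
    simp only [hτ]
    gcongr
  have hd : ∀ t ∈ Set.Ioo 0 x, HasDerivAt
      (fun t => binomialTail m (a + 1) t - (1 - stdNormalCDF √(2 * m * bernoulliKL x t)))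
      (t ^ a * (1 - t) ^ b * (C - L * τ t)) t := by
    intro t ht
    have ht0 := ht.1
    have ht1 : 0 < 1 - t := by linarith [ht.2]
    have hxt : 0 < x - t := by linarith [ht.2]
    have hD := bernoulliKL_pos ht.1 ht.2 hx1
    have hmD : 0 < 2 * m * bernoulliKL x t := by positivity
    have h1 := (hF t).sub (((hasDerivAt_stdNormalCDF √(2 * m * bernoulliKL x t)).comp t
      (((hasDerivAt_bernoulliKL x ht.1 (by linarith)).const_mul (2 * (m : ℝ))).sqrt
        hmD.ne')).const_sub 1)
    refine h1.congr_deriv ?_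
    have hτt : τ t = (x - t) / (1 - t) / √(2 * m * bernoulliKL x t) := by
      simp only [hτ]
      rw [div_div, sqrt_div (by positivity), sqrt_sq (by positivity)]
      congr 2
      ring
    have hexp : exp (-√(2 * m * bernoulliKL x t) ^ 2 / 2) =
        t ^ (a + 1) * (1 - t) ^ b / (x ^ (a + 1) * (1 - x) ^ b) := by
      rw [sq_sqrt hmD.le, pow_mul_pow_eq_exp_bernoulliKL hmx hb hx0 hx1 ht0 (by linarith),
        mul_div_cancel_left₀ _ (by positivity)]
      congr 1
      ring
    rw [hτt, hexp, hL]
    have hs : √(2 * m * bernoulliKL x t) ≠ 0 := by positivity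
    field_simp
    ring
  have hx_half := half_le_binomialTail hx0 hx1 hmx ham
  have key := nonneg_of_deriv_sign_change (p := p) (x := x)
    (W := fun t => binomialTail m (a + 1) t - (1 - stdNormalCDF √(2 * m * bernoulliKL x t)))
    (fun t ht => by
      have h1 := (hF t).continuousAt
      have h2 := (hasDerivAt_bernoulliKL x ht.1 (ht.2.trans_lt hx1)).continuousAt
      have h3 : ContinuousAt (fun t => stdNormalCDF √(2 * m * bernoulliKL x t)) t :=
        (hasDerivAt_stdNormalCDF _).continuousAt.comp
          (f := fun t => √(2 * m * bernoulliKL x t)) (h2.const_mul (2 * (m : ℝ))).sqrt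
      exact (h1.sub (continuousAt_const.sub h3)).continuousWithinAt)
    hd
    (fun s t hs hst ht hpos => by
      have hpow : ∀ r, 0 < r → r < x → 0 < r ^ a * (1 - r) ^ b := fun r hr hrx => by
        have : 0 < 1 - r := by linarith
        positivity
      have h1 := (pos_iff_pos_of_mul_pos hpos).1 (hpow t (hs.trans_le hst) ht)
      have h2 := mul_le_mul_of_nonneg_left
        (hτmono ⟨hs, hst.trans_lt ht⟩ ⟨hs.trans_le hst, ht⟩ hst) hLpos.le
      exact mul_nonneg (hpow s hs (hst.trans_lt ht)).le (by linarith))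
    (by
      simp only [bernoulliKL_self, mul_zero, sqrt_zero, stdNormalCDF_zero]
      linarith)
    (fun ε hε => by
      have h1 := tendsto_stdNormalCDF_atTop.comp (tendsto_sqrt_atTop.comp
        ((tendsto_bernoulliKL_zero hx0).const_mul_atTop (by positivity : (0 : ℝ) < 2 * m)))
      filter_upwards [h1.eventually (lt_mem_nhds (by linarith : 1 - ε < 1)),
        Ioc_mem_nhdsGT one_pos] with t ht ht1
      have := binomialTail_nonneg m (a + 1) ht1.1.le ht1.2
      simp only [Function.comp] at ht
      linarith)
    ⟨hp0, hpx⟩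
  linarith

/-- Slud's inequality (the special case used in the paper): for X ~ Binomial(m, μ) with
    μ ≤ 1/2 and an integer k with mμ ≤ k ≤ m(1 − μ),
    P(X ≥ k) ≥ 1 − Φ((k − mμ)/√(mμ(1 − μ))). -/
theorem stmt5 (m : ℕ) (μ : ℝ) (hμ0 : 0 < μ) (hμ : μ ≤ 1/2)
    (k : ℕ) (hk1 : (m : ℝ) * μ ≤ k) (hk2 : (k : ℝ) ≤ (m : ℝ) * (1 - μ)) :
    1 - stdNormalCDF (((k : ℝ) - m * μ) / Real.sqrt (m * μ * (1 - μ))) ≤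
      ∑ j ∈ Finset.Icc k m, (m.choose j : ℝ) * μ ^ j * (1 - μ) ^ (m - j) := by
  change _ ≤ binomialTail m k μ
  have hμ1 : 0 < 1 - μ := by linarith
  rcases k with _ | a
  · have h0 := monotone_stdNormalCDF.ge_of_tendsto tendsto_stdNormalCDF_atTop
    rw [binomialTail_zero, sub_le_self_iff]
    exact MeasureTheory.integral_nonneg fun s => by positivity
  have hm0 : 0 < (m : ℝ) := by
    by_contra! h
    have : (m : ℝ) = 0 := le_antisymm h (Nat.cast_nonneg m)
    rw [this] at hk2
    push_cast at hk2
    linarith [(Nat.cast_nonneg a : (0 : ℝ) ≤ a)]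
  have ham : a + 1 < m := by
    have : ((a + 1 : ℕ) : ℝ) < m := hk2.trans_lt (by nlinarith)
    exact_mod_cast this
  set x : ℝ := (a + 1 : ℕ) / m with hx
  have hmx : m * x = (a + 1 : ℕ) := by rw [hx]; field_simp
  have hpx : μ ≤ x := by rw [hx, le_div_iff₀ hm0]; linarith
  have hx1 : x ≤ 1 - μ := by rw [hx, div_le_iff₀ hm0]; linarith
  refine le_trans ?_ (one_sub_stdNormalCDF_sqrt_le_binomialTail (by linarith) hmx ham hμ0 hpx)
  refine sub_le_sub_left (monotone_stdNormalCDF ?_) 1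
  have hD := bernoulliKL_le_of_le_one_sub hμ0 hpx hx1
  rw [← hmx, ← mul_sub]
  refine sqrt_le_iff.2 ⟨div_nonneg (mul_nonneg hm0.le (by linarith)) (sqrt_nonneg _), ?_⟩
  rw [div_pow, sq_sqrt (by positivity)]
  calc 2 * m * bernoulliKL x μ ≤ 2 * m * ((x - μ) ^ 2 / (2 * (μ * (1 - μ)))) := by gcongr
    _ = _ := by field_simp
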